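/- arXiv:2102.00559 — 3 statements merged into one kernel-verified Lean document; each statement's English description precedes it below -/
import Mathlib

section
/- Let G be a finite group in which every Sylow subgroup is cyclic, and let N = |G|. For every divisor d of N there exists a subgroup of G of order d, and any two subgroups of G of order d are conjugate in G. -/
open scoped IsMulCommutative Pointwise in
theorem sz_conj_aux {G : Type*} [Group G] [Finite G] (N : Subgroup G) [N.Normal]
    [IsMulCommutative N] (hN : (Nat.card N).Coprime N.index) (K₁ K₂ : Subgroup G)
    (h₁ : N.IsComplement' K₁) (h₂ : N.IsComplement' K₂) :
    ∃ g : G, K₂ = K₁.map (MulAut.conj g).toMonoidHom := by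
  have key : ∀ K : Subgroup G, N.IsComplement' K →
      ∃ α : N.QuotientDiff, MulAction.stabilizer G α = K := by
    intro K hK
    let T : N.LeftTransversal := ⟨(K : Set G), hK.symm⟩
    let α : N.QuotientDiff := Quotient.mk'' T
    refine ⟨α, ?_⟩
    symm
    apply Subgroup.eq_of_le_of_card_ge
    · intro g hg
      rw [MulAction.mem_stabilizer_iff]
      change Quotient.mk'' (MulOpposite.op g⁻¹ • T) = Quotient.mk'' T
      congr 1
      apply Subtype.ext
      change MulOpposite.op g⁻¹ • (K : Set G) = (K : Set G)
      exact op_smul_coe_set (K.inv_mem hg)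
    · have h1 := (Subgroup.isComplement'_stabilizer_of_coprime (α := α) hN).card_mul_card
      have h2 := hK.card_mul_card
      rw [← h2] at h1
      exact (Nat.eq_of_mul_eq_mul_left Nat.card_pos h1).le
  obtain ⟨α, rfl⟩ := key K₁ h₁
  obtain ⟨β, rfl⟩ := key K₂ h₂
  obtain ⟨h, rfl⟩ := Subgroup.exists_smul_eq hN α β
  exact ⟨h, MulAction.stabilizer_smul_eq_stabilizer_map_conj (h : G) α⟩

theorem sz_conj {G : Type*} [Group G] [Finite G] (N : Subgroup G) [N.Normal]
    [IsMulCommutative N] (L₁ L₂ : Subgroup G) (hc : (Nat.card N).Coprime (Nat.card L₁))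
    (hcard : Nat.card L₁ = Nat.card L₂) (hs : L₁ ⊔ N = L₂ ⊔ N) :
    ∃ g : G, L₂ = L₁.map (MulAut.conj g).toMonoidHom := by
  obtain ⟨M, hM⟩ : ∃ M, M = L₁ ⊔ N := ⟨_, rfl⟩
  have hNM : N ≤ M := hM ▸ le_sup_right
  have h1M : L₁ ≤ M := hM ▸ le_sup_left
  have h2M : L₂ ≤ M := by rw [hM, hs]; exact le_sup_left
  have cN : Nat.card (N.subgroupOf M) = Nat.card N :=
    Nat.card_congr (Subgroup.subgroupOfEquivOfLe hNM).toEquiv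
  have c1 : Nat.card (L₁.subgroupOf M) = Nat.card L₁ :=
    Nat.card_congr (Subgroup.subgroupOfEquivOfLe h1M).toEquiv
  have c2 : Nat.card (L₂.subgroupOf M) = Nat.card L₂ :=
    Nat.card_congr (Subgroup.subgroupOfEquivOfLe h2M).toEquiv
  have hidx : (N.subgroupOf M).index = Nat.card L₁ := by
    change N.relIndex M = _
    rw [hM, Subgroup.relIndex_sup_right, ← Subgroup.inf_relIndex_right,
      (Subgroup.disjoint_of_coprime_natCard hc).eq_bot, Subgroup.relIndex_bot_left]
  have hprod := (N.subgroupOf M).card_mul_index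
  have : IsMulCommutative (N.subgroupOf M) :=
    inferInstance
  obtain ⟨g, hg⟩ := sz_conj_aux (N.subgroupOf M) (by rw [cN, hidx]; exact hc)
    (L₁.subgroupOf M) (L₂.subgroupOf M)
    (Subgroup.isComplement'_of_coprime (by rw [c1, ← hidx, hprod]) (by rw [cN, c1]; exact hc))
    (Subgroup.isComplement'_of_coprime (by rw [c2, ← hcard, ← hidx, hprod])
      (by rw [cN, c2, ← hcard]; exact hc))
  refine ⟨g, ?_⟩
  have := congrArg (Subgroup.map M.subtype) hg
  rw [Subgroup.map_map, Subgroup.map_subgroupOf_eq_of_le h2M] at this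
  rw [this]
  conv_rhs => rw [← Subgroup.map_subgroupOf_eq_of_le h1M]
  rw [Subgroup.map_map]
  rfl

theorem cyc_mem {C : Type*} [Group C] [Finite C] [IsCyclic C] (H : Subgroup C) (x : C) :
    x ∈ H ↔ x ^ Nat.card H = 1 := by
  classical
  have := Fintype.ofFinite C
  constructor
  · intro hx
    have := congrArg Subtype.val (pow_card_eq_one' (x := (⟨x, hx⟩ : H)))
    exact this
  · intro hx
    have h1 := IsCyclic.card_pow_eq_one_le (α := C) (n := Nat.card H) Nat.card_pos
    have h2 : (Finset.univ.filter (fun y : C => y ∈ H)) ⊆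
        Finset.univ.filter (fun y : C => y ^ Nat.card H = 1) := by
      intro y hy
      simp only [Finset.mem_filter, Finset.mem_univ, true_and] at hy ⊢
      have := congrArg Subtype.val (pow_card_eq_one' (x := (⟨y, hy⟩ : H)))
      exact this
    have h3 : (Finset.univ.filter (fun y : C => y ∈ H)).card = Nat.card H := by
      rw [Nat.card_eq_fintype_card]
      exact (Fintype.card_subtype _).symm
    have h4 := Finset.eq_of_subset_of_card_le h2 (by rw [h3]; exact h1)
    have : x ∈ Finset.univ.filter (fun y : C => y ∈ H) := by
      rw [h4]; simpa using hx
    simpa using this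

theorem cyc_mem_le {G : Type*} [Group G] [Finite G] (N D : Subgroup G) [IsCyclic N]
    (hD : D ≤ N) (x : G) : x ∈ D ↔ x ∈ N ∧ x ^ Nat.card D = 1 := by
  have hc : Nat.card (D.subgroupOf N) = Nat.card D :=
    Nat.card_congr (Subgroup.subgroupOfEquivOfLe hD).toEquiv
  constructor
  · intro h
    have := (cyc_mem (D.subgroupOf N) ⟨x, hD h⟩).1 h
    rw [hc] at this
    exact ⟨hD h, by simpa using congrArg Subtype.val this⟩
  · rintro ⟨h, hpow⟩
    exact (cyc_mem (D.subgroupOf N) ⟨x, h⟩).2 (by rw [hc]; exact Subtype.ext (by simpa using hpow))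

theorem cyc_normal {G : Type*} [Group G] [Finite G] (N D : Subgroup G) [N.Normal] [IsCyclic N]
    (hD : D ≤ N) : D.Normal := by
  refine ⟨fun x hx g => ?_⟩
  rw [cyc_mem_le N D hD] at hx ⊢
  exact ⟨Subgroup.Normal.conj_mem inferInstance x hx.1 g, by rw [conj_pow, hx.2]; simp⟩

theorem cyc_exists {G : Type*} [Group G] [Finite G] (N : Subgroup G) [IsCyclic N] (d : ℕ)
    (hd : d ∣ Nat.card N) : ∃ D : Subgroup G, D ≤ N ∧ Nat.card D = d := by
  obtain ⟨g, hg⟩ := IsCyclic.exists_ofOrder_eq_natCard (α := N)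
  obtain ⟨k, hk⟩ := hd
  have hpos : 0 < Nat.card N := Nat.card_pos
  have hk0 : k ≠ 0 := by rintro rfl; omega
  refine ⟨Subgroup.zpowers ((g : G) ^ k), ?_, ?_⟩
  · rw [Subgroup.zpowers_le]
    exact N.pow_mem g.2 k
  · rw [Nat.card_zpowers, orderOf_pow_of_dvd hk0, Subgroup.orderOf_coe, hg, hk,
      Nat.mul_div_cancel _ (Nat.pos_of_ne_zero hk0)]
    rw [Subgroup.orderOf_coe, hg, hk]
    exact dvd_mul_left _ _

theorem card_sup_coprime {G : Type*} [Group G] [Finite G] (D L : Subgroup G) [D.Normal]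
    (hc : (Nat.card D).Coprime (Nat.card L)) :
    Nat.card (L ⊔ D : Subgroup G) = Nat.card D * Nat.card L := by
  rw [← Subgroup.relIndex_bot_left, ← Subgroup.relIndex_mul_relIndex ⊥ D _ bot_le le_sup_right,
    Subgroup.relIndex_bot_left, Subgroup.relIndex_sup_right, ← Subgroup.inf_relIndex_right,
      (Subgroup.disjoint_of_coprime_natCard hc).eq_bot, Subgroup.relIndex_bot_left]

theorem decomp {G : Type*} [Group G] [Finite G] (N H : Subgroup G) [N.Normal]
    (hN : (Nat.card N).Coprime N.index) :
    ∃ L : Subgroup G, H = (N ⊓ H) ⊔ L ∧ Nat.card L = (Nat.card H).gcd N.index ∧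
      Nat.card (N ⊓ H : Subgroup G) = (Nat.card H).gcd (Nat.card N) := by
  have ha : Nat.card (N ⊓ H : Subgroup G) ∣ Nat.card N := Subgroup.card_dvd_of_le inf_le_left
  have hb : N.relIndex H ∣ N.index := Subgroup.relIndex_dvd_index_of_normal N H
  have hab : Nat.card (N ⊓ H : Subgroup G) * N.relIndex H = Nat.card H := by
    rw [← Subgroup.inf_relIndex_right, ← Subgroup.relIndex_bot_left,
      Subgroup.relIndex_mul_relIndex ⊥ _ _ bot_le inf_le_right, Subgroup.relIndex_bot_left]
  have hc : Nat.card (N.subgroupOf H) = Nat.card (N ⊓ H : Subgroup G) := by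
    rw [← Subgroup.inf_subgroupOf_right]
    exact Nat.card_congr (Subgroup.subgroupOfEquivOfLe inf_le_right).toEquiv
  have hcop : (Nat.card (N.subgroupOf H)).Coprime (N.subgroupOf H).index := by
    rw [hc]
    exact (hN.coprime_dvd_left ha).coprime_dvd_right hb
  obtain ⟨L, hL⟩ := Subgroup.exists_right_complement'_of_coprime hcop
  refine ⟨L.map H.subtype, ?_, ?_, ?_⟩
  · have := congrArg (Subgroup.map H.subtype) hL.sup_eq_top
    rw [Subgroup.map_sup, Subgroup.subgroupOf_map_subtype, ← MonoidHom.range_eq_map,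
      Subgroup.range_subtype] at this
    exact this.symm
  · rw [Subgroup.card_map_of_injective H.subtype_injective, ← hL.symm.index_eq_card, ← hab,
      Nat.Coprime.gcd_mul_left_cancel _ (hN.coprime_dvd_left ha)]
    exact (Nat.gcd_eq_left hb).symm
  · rw [← hab, Nat.Coprime.gcd_mul_right_cancel _ (hN.coprime_dvd_right hb).symm]
    exact (Nat.gcd_eq_left ha).symm


theorem stmt_13 {G : Type*} [Group G] [Fintype G]
    (hsyl : ∀ p : ℕ, p.Prime → ∀ P : Sylow p G, IsCyclic P)
    (d : ℕ) (hd : d ∣ Fintype.card G) :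
    (∃ H : Subgroup G, Nat.card H = d) ∧
    ∀ H₁ H₂ : Subgroup G, Nat.card H₁ = d → Nat.card H₂ = d →
      ∃ g : G, H₂ = H₁.map (MulAut.conj g).toMonoidHom := by
  have hZ : IsZGroup G := ⟨hsyl⟩
  have hcop := IsZGroup.coprime_commutator_index G
  have hcyc := IsZGroup.isCyclic_commutator G
  have hab : IsCyclic (Abelianization G) := inferInstance
  obtain ⟨N, hN⟩ : ∃ N, N = commutator G := ⟨_, rfl⟩
  have hker : (Abelianization.of (G := G)).ker = N := hN ▸ Abelianization.ker_of G
  have hNn : N.Normal := hN ▸ inferInstance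
  rw [← hN] at hcop hcyc
  rw [← Nat.card_eq_fintype_card] at hd
  have hdgcd : (d.gcd (Nat.card N)) * (d.gcd N.index) = d := by
    rw [← hcop.gcd_mul, N.card_mul_index]
    exact Nat.gcd_eq_left hd
  have hinj : ∀ L : Subgroup G, (Nat.card N).Coprime (Nat.card L) →
      Function.Injective (Abelianization.of.comp L.subtype) := by
    intro L hL
    rw [← MonoidHom.ker_eq_bot_iff, eq_bot_iff]
    intro x hx
    have h1 : (x : G) ∈ N := by rw [← hker]; exact hx
    have := (Subgroup.disjoint_of_coprime_natCard hL).le_bot ⟨h1, x.2⟩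
    exact Subtype.ext this
  constructor
  · obtain ⟨K, hK⟩ := Subgroup.exists_right_complement'_of_coprime hcop
    have hKc : Nat.card K = N.index := hK.symm.index_eq_card.symm
    have : IsCyclic K := isCyclic_of_injective _ (hinj K (by rw [hKc]; exact hcop))
    obtain ⟨D, hDN, hD⟩ := cyc_exists N _ (Nat.gcd_dvd_right d (Nat.card N))
    obtain ⟨L, hLK, hL⟩ := cyc_exists K (d.gcd N.index) (by rw [hKc]; exact Nat.gcd_dvd_right _ _)
    have := cyc_normal N D hDN
    refine ⟨L ⊔ D, ?_⟩
    rw [card_sup_coprime, hD, hL, hdgcd]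
    rw [hD, hL]
    exact (hcop.coprime_dvd_left (Nat.gcd_dvd_right _ _)).coprime_dvd_right (Nat.gcd_dvd_right _ _)
  · intro H₁ H₂ h₁ h₂
    obtain ⟨L₁, e₁, l₁, d₁⟩ := decomp N H₁ hcop
    obtain ⟨L₂, e₂, l₂, d₂⟩ := decomp N H₂ hcop
    rw [h₁] at l₁ d₁
    rw [h₂] at l₂ d₂
    have c₁ : (Nat.card N).Coprime (Nat.card L₁) := by
      rw [l₁]; exact hcop.coprime_dvd_right (Nat.gcd_dvd_right _ _)
    have c₂ : (Nat.card N).Coprime (Nat.card L₂) := by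
      rw [l₂]; exact hcop.coprime_dvd_right (Nat.gcd_dvd_right _ _)
    have hD : N ⊓ H₂ = N ⊓ H₁ := by
      ext x
      rw [cyc_mem_le N _ inf_le_left, cyc_mem_le N (N ⊓ H₁) inf_le_left, d₁, d₂]
    have cm : ∀ L : Subgroup G, (Nat.card N).Coprime (Nat.card L) →
        Nat.card (L.map Abelianization.of) = Nat.card L := by
      intro L hL
      have h : Nat.card ((⊤ : Subgroup L).map (Abelianization.of.comp L.subtype)) =
          Nat.card (⊤ : Subgroup L) :=
        Nat.card_congr ((⊤ : Subgroup L).equivMapOfInjective _ (hinj L hL)).symm.toEquiv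
      rw [← Subgroup.map_map, ← MonoidHom.range_eq_map, Subgroup.range_subtype,
        Subgroup.card_top] at h
      exact h
    have hmap : L₁.map Abelianization.of = L₂.map Abelianization.of := by
      ext x
      rw [cyc_mem, cyc_mem, cm _ c₁, cm _ c₂, l₁, l₂]
    have hs := congrArg (Subgroup.comap Abelianization.of) hmap
    rw [Subgroup.comap_map_eq, Subgroup.comap_map_eq, hker] at hs
    have : IsMulCommutative N := inferInstance
    obtain ⟨g, hg⟩ := sz_conj N L₁ L₂ c₁ (l₁.trans l₂.symm) hs
    refine ⟨g, ?_⟩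
    have hn := cyc_normal N (N ⊓ H₁) inf_le_left
    have hconj : (N ⊓ H₁).map (MulAut.conj g).toMonoidHom = N ⊓ H₁ :=
      Subgroup.Normal.map_conj_eq (N ⊓ H₁) g
    rw [e₂, hD, hg]
    conv_rhs => rw [e₁, Subgroup.map_sup, hconj]
end

section
/- Let A and B be finite cyclic groups with gcd(|A|, |B|) = 1, and let G = A ⋊ B be a semidirect product with action homomorphism φ: B → Aut(A) having kernel K. Then G is freely representable (over ℂ) if and only if every prime dividing |B| divides |K|. -/
universe u

/-- A finite group is freely representable (over ℂ) if it admits a complex linear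
representation on a nonzero vector space in which every nonidentity element fixes
only the zero vector. -/
def FreelyRepresentable (G : Type u) [Group G] : Prop :=
  ∃ (V : Type u) (_ : AddCommGroup V) (_ : Module ℂ V)
    (ρ : Representation ℂ G V),
    (∃ v : V, v ≠ 0) ∧ ∀ g : G, g ≠ 1 → ∀ v : V, v ≠ 0 → ρ g v ≠ v

theorem fr_exists_char (A : Type) [Group A] [Finite A] [IsCyclic A] :
    ∃ α : A →* ℂˣ, Function.Injective α := by
  have : NeZero (Nat.card A) := ⟨Nat.card_pos.ne'⟩
  have h : Nat.card A = Nat.card (rootsOfUnity (Nat.card A) ℂ) := by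
    rw [Complex.card_rootsOfUnity]
  let e : A ≃* rootsOfUnity (Nat.card A) ℂ := mulEquivOfCyclicCardEq h
  exact ⟨(rootsOfUnity (Nat.card A) ℂ).subtype.comp e.toMonoidHom,
    Subtype.val_injective.comp e.injective⟩

theorem fr_mem_of_order {B : Type} [Group B] [Finite B] [IsCyclic B] (K : Subgroup B) (p : ℕ)
    (hp : p.Prime) (hK : p ∣ Nat.card K) (b : B) (hb : orderOf b = p) : b ∈ K := by
  have := Fact.mk hp
  obtain ⟨k, hk⟩ := exists_prime_orderOf_dvd_card' p hK
  have hk' : orderOf (k : B) = p := by rw [← hk]; exact Subgroup.orderOf_coe k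
  obtain ⟨β, hβ⟩ := fr_exists_char B
  have hζ : IsPrimitiveRoot (β k) p := by
    have h := IsPrimitiveRoot.orderOf (β (k : B))
    rwa [orderOf_injective β hβ, hk'] at h
  have hζ' : IsPrimitiveRoot ((β k : ℂˣ) : ℂ) p := IsPrimitiveRoot.coe_units_iff.mpr hζ
  have hbp : ((β b : ℂˣ) : ℂ) ^ p = 1 := by
    rw [← Units.val_pow_eq_pow_val, ← map_pow, ← hb, pow_orderOf_eq_one, map_one, Units.val_one]
  have : NeZero p := ⟨hp.ne_zero⟩
  obtain ⟨i, -, hi⟩ := hζ'.eq_pow_of_pow_eq_one hbp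
  have hbk : (k : B) ^ i = b := by
    apply hβ
    rw [map_pow]
    exact Units.ext (by simpa using hi)
  rw [← hbk]
  exact pow_mem k.2 i

theorem fr_backward {A B : Type} [Group A] [Group B] [Finite A] [Finite B]
    [IsCyclic A] [IsCyclic B]
    (hcop : Nat.Coprime (Nat.card A) (Nat.card B))
    (φ : B →* MulAut A)
    (H : ∀ p : ℕ, p.Prime → p ∣ Nat.card B → p ∣ Nat.card φ.ker) :
    FreelyRepresentable (A ⋊[φ] B) := by
  obtain ⟨α, hα⟩ := fr_exists_char A
  obtain ⟨β, hβ⟩ := fr_exists_char B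
  let c : A ⋊[φ] B → ℂ := fun g => ((α g.left * β g.right : ℂˣ) : ℂ)
  let W : Submodule ℂ (A ⋊[φ] B → ℂ) :=
    { carrier := {f | ∀ n g : A ⋊[φ] B, φ n.right = 1 → f (n * g) = c n * f g}
      add_mem' := by
        intro f f' hf hf' n g hn
        simp only [Pi.add_apply, hf n g hn, hf' n g hn, mul_add]
      zero_mem' := by intro n g hn; simp
      smul_mem' := by
        intro r f hf n g hn
        simp only [Pi.smul_apply, hf n g hn, smul_eq_mul]; ring }
  let ρ : Representation ℂ (A ⋊[φ] B) W :=
    { toFun := fun h =>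
        { toFun := fun f => ⟨fun g => f.1 (g * h), fun n g hn => by
            simpa only [mul_assoc] using f.2 n (g * h) hn⟩
          map_add' := fun _ _ => rfl
          map_smul' := fun _ _ => rfl }
      map_one' := by
        ext f g
        change f.1 (g * 1) = f.1 g
        rw [mul_one]
      map_mul' := by
        intro h k
        ext f g
        change f.1 (g * (h * k)) = f.1 (g * h * k)
        rw [mul_assoc] }
  have hρ : ∀ h (f : W) g, (ρ h f).1 g = f.1 (g * h) := fun _ _ _ => rfl
  refine ⟨W, inferInstance, inferInstance, ρ, ⟨⟨c, ?_⟩, ?_⟩, ?_⟩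
  · intro n g hn
    simp only [c, SemidirectProduct.mul_left, SemidirectProduct.mul_right, hn, MulAut.one_apply,
      map_mul, Units.val_mul]
    ring
  · intro h
    have := congrFun (congrArg Subtype.val h) 1
    exact Units.ne_zero (α (1 : A ⋊[φ] B).left * β (1 : A ⋊[φ] B).right) this
  · -- freeness
    intro h hh v hv hfix
    have : Finite (A ⋊[φ] B) := Finite.of_equiv _ SemidirectProduct.equivProd.symm
    have hpow : ∀ k : ℕ, ρ (h ^ k) v = v := by
      intro k
      induction k with
      | zero => simp
      | succ k ih => rw [pow_succ, map_mul, Module.End.mul_apply, hfix, ih]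
    have ho : orderOf h ≠ 1 := fun h1 => hh (orderOf_eq_one_iff.mp h1)
    obtain ⟨p, hp, m, hm⟩ := Nat.exists_prime_and_dvd ho
    have hopos : 0 < orderOf h := orderOf_pos h
    have hx : orderOf (h ^ m) = p := by
      have hm0 : m ≠ 0 := by rintro rfl; rw [mul_zero] at hm; omega
      rw [orderOf_pow_of_dvd hm0 ⟨p, by rw [hm, mul_comm]⟩, hm]
      exact Nat.mul_div_cancel _ (Nat.pos_of_ne_zero hm0)
    have hfx := hpow m
    generalize h ^ m = x at hx hfx
    have hx1 : x ≠ 1 := by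
      rintro rfl; rw [orderOf_one] at hx; exact hp.one_lt.ne hx
    have hxp : x ^ p = 1 := by rw [← hx]; exact pow_orderOf_eq_one x
    have hxr : φ x.right = 1 := by
      have hb : x.right ^ p = 1 := by
        have := congrArg (SemidirectProduct.rightHom (φ := φ)) hxp
        rwa [map_pow, map_one] at this
      by_cases hb1 : x.right = 1
      · rw [hb1, map_one]
      · have := Fact.mk hp
        have ho := orderOf_eq_prime hb hb1
        exact fr_mem_of_order φ.ker p hp (H p hp (ho ▸ orderOf_dvd_natCard x.right)) _ ho
    apply hv
    ext g
    change v.1 g = 0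
    have h1 : v.1 (g * x) = v.1 g := by rw [← hρ, hfx]
    have hy : φ (g * x * g⁻¹).right = 1 := by
      simp [hxr]
    have h2 := v.2 (g * x * g⁻¹) g hy
    rw [inv_mul_cancel_right, h1] at h2
    by_contra h0
    have h3 : c (g * x * g⁻¹) = 1 := by
      have : (c (g * x * g⁻¹) - 1) * v.1 g = 0 := by rw [sub_mul, one_mul, ← h2, sub_self]
      rcases mul_eq_zero.mp this with h | h
      · exact sub_eq_zero.mp h
      · exact absurd h h0
    have hy1 : g * x * g⁻¹ ≠ 1 := by
      intro h
      exact hx1 (conj_eq_one_iff.mp h)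
    generalize g * x * g⁻¹ = y at h3 hy1
    have h4 : α y.left * β y.right = 1 := Units.ext h3
    have ha : α y.left = 1 := by
      rw [← orderOf_eq_one_iff]
      apply Nat.eq_one_of_dvd_coprimes hcop
      · exact (orderOf_map_dvd α _).trans (orderOf_dvd_natCard _)
      · rw [eq_inv_of_mul_eq_one_left h4, orderOf_inv]
        exact (orderOf_map_dvd β _).trans (orderOf_dvd_natCard _)
    rw [ha, one_mul] at h4
    apply hy1
    ext
    · exact hα (by simpa using ha)
    · exact hβ (by simpa using h4)

theorem fr_forward {A B : Type} [Group A] [Group B] [Finite A] [Finite B]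
    [IsCyclic A] [IsCyclic B]
    (φ : B →* MulAut A) (hF : FreelyRepresentable (A ⋊[φ] B))
    (p : ℕ) (hp : p.Prime) (hpB : p ∣ Nat.card B) : p ∣ Nat.card φ.ker := by
  classical
  have := Fact.mk hp
  let := Fintype.ofFinite A
  obtain ⟨V, _, _, ρ, ⟨v, hv⟩, hfree⟩ := hF
  have comm : ∀ x y : A, x * y = y * x := by
    let := IsCyclic.commGroup (α := A)
    exact fun x y => mul_comm x y
  obtain ⟨b, hb⟩ := exists_prime_orderOf_dvd_card' p hpB
  suffices hk : b ∈ φ.ker by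
    have : orderOf (⟨b, hk⟩ : φ.ker) = p := by rw [← hb]; exact Subgroup.orderOf_mk b hk
    rw [← this]
    exact orderOf_dvd_natCard _
  by_contra hk
  have hb1 : b ≠ 1 := by rintro rfl; exact hk (one_mem _)
  have hbp : b ^ p = 1 := by rw [← hb]; exact pow_orderOf_eq_one b
  let y : A → A ⋊[φ] B := fun a =>
    SemidirectProduct.inl a * SemidirectProduct.inr b * (SemidirectProduct.inl a)⁻¹
  have hy1 : ∀ a, y a ≠ 1 := by
    intro a h
    have := conj_eq_one_iff.mp h
    exact hb1 (SemidirectProduct.inr_injective (by simpa using this))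
  have hyp : ∀ a, y a ^ p = 1 := by
    intro a
    rw [conj_pow, ← map_pow, hbp]; simp
  -- each conjugate sum vanishes
  have S1 : ∀ a, ∑ i ∈ Finset.range p, ρ (y a ^ i) v = 0 := by
    intro a
    by_contra h0
    apply hfree (y a) (hy1 a) _ h0
    rw [map_sum]
    simp_rw [← Module.End.mul_apply, ← map_mul, ← pow_succ']
    have e1 := Finset.sum_range_succ (fun i => ρ (y a ^ i) v) p
    have e2 := Finset.sum_range_succ' (fun i => ρ (y a ^ i) v) p
    rw [e1, hyp, pow_zero] at e2
    exact (add_right_cancel e2).symm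
  let ψ : ℕ → A → A := fun i a => a * φ (b ^ i) a⁻¹
  have hψm : ∀ i a a', ψ i (a * a') = ψ i a * ψ i a' := by
    intro i a a'
    simp only [ψ, mul_inv_rev, map_mul]
    rw [comm (φ (b ^ i) a'⁻¹), mul_assoc, mul_assoc, ← mul_assoc a', comm a' (φ (b ^ i) a⁻¹),
      mul_assoc]
  have hyψ : ∀ a i, y a ^ i = SemidirectProduct.inl (ψ i a) * SemidirectProduct.inr (b ^ i) := by
    intro a i
    have e : y a ^ i = SemidirectProduct.inl a * SemidirectProduct.inr (b ^ i) *
        (SemidirectProduct.inl a)⁻¹ := by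
      rw [map_pow]; exact conj_pow
    rw [e]
    generalize hd : b ^ i = d
    have hφd : φ d = φ b ^ i := by rw [← hd, map_pow]
    ext <;> simp [ψ, hφd]
  have S2 : ∀ i, i ∈ Finset.range p → i ≠ 0 → ∑ a : A, ρ (y a ^ i) v = 0 := by
    intro i hi hi0
    have hφ : φ (b ^ i) ≠ 1 := by
      intro h
      apply hk
      have hc : (orderOf b).Coprime i := by
        rw [hb]
        exact (Nat.Prime.coprime_iff_not_dvd hp).mpr
          (Nat.not_dvd_of_pos_of_lt (Nat.pos_of_ne_zero hi0) (Finset.mem_range.mp hi))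
      obtain ⟨m, hm⟩ := exists_pow_eq_self_of_coprime hc.symm
      rw [← hm]
      exact pow_mem (show b ^ i ∈ φ.ker from h) m
    obtain ⟨a0, ha0⟩ : ∃ a0, ψ i a0 ≠ 1 := by
      by_contra! hall
      apply hφ
      ext a
      have := hall a
      simp only [ψ, map_inv] at this
      exact (mul_inv_eq_one.mp this).symm
    by_contra h0
    refine hfree (SemidirectProduct.inl (ψ i a0)) ?_ _ h0 ?_
    · intro h
      exact ha0 (SemidirectProduct.inl_injective (by simpa using h))
    · rw [map_sum]
      simp_rw [← Module.End.mul_apply, ← map_mul, hyψ, ← mul_assoc, ← map_mul, ← hψm]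
      exact Fintype.sum_equiv (Equiv.mulLeft a0) _ _ (fun _ => rfl)
  have S3 : ∑ i ∈ Finset.range p, ∑ a : A, ρ (y a ^ i) v = 0 := by
    rw [Finset.sum_comm]
    exact Finset.sum_eq_zero fun a _ => S1 a
  rw [Finset.sum_eq_single_of_mem 0 (Finset.mem_range.mpr hp.pos) S2] at S3
  simp only [pow_zero, map_one, Module.End.one_apply, Finset.sum_const, Finset.card_univ] at S3
  rw [← Nat.cast_smul_eq_nsmul ℂ] at S3
  rcases smul_eq_zero.mp S3 with h | h
  · exact Fintype.card_ne_zero (α := A) (by exact_mod_cast h)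
  · exact hv h

theorem stmt_15 {A B : Type} [Group A] [Group B] [Finite A] [Finite B]
    [IsCyclic A] [IsCyclic B]
    (hcop : Nat.Coprime (Nat.card A) (Nat.card B))
    (φ : B →* MulAut A) :
    FreelyRepresentable (A ⋊[φ] B) ↔
      ∀ p : ℕ, p.Prime → p ∣ Nat.card B → p ∣ Nat.card φ.ker :=
  ⟨fun h p hp hpB => fr_forward φ h p hp hpB, fr_backward hcop φ⟩
end

section
/- Let p be an odd prime and let C, C' be cyclic subgroups of SL₂(𝔽_p) of the same order. Then C and C' are conjugate in SL₂(𝔽_p), and if C ≠ C' then C ∩ C' ⊆ {±I}. -/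
open Matrix

lemma sl_coe_pow {F : Type*} [Field F] (g : SpecialLinearGroup (Fin 2) F) (k : ℕ) :
    (g ^ k).1 = g.1 ^ k := Matrix.SpecialLinearGroup.coe_pow g k

lemma sl_coe_mul {F : Type*} [Field F] (g h : SpecialLinearGroup (Fin 2) F) :
    (g * h).1 = g.1 * h.1 := Matrix.SpecialLinearGroup.coe_mul g h

lemma sl_ext {F : Type*} [Field F] {g h : SpecialLinearGroup (Fin 2) F} (e : g.1 = h.1) :
    g = h := Subtype.ext e

lemma sl_pow_one {F : Type*} [Field F] (g : SpecialLinearGroup (Fin 2) F) (k : ℕ) :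
    g ^ k = 1 ↔ g.1 ^ k = 1 := by
  rw [← sl_coe_pow]
  exact ⟨fun h => by rw [h]; exact Matrix.SpecialLinearGroup.coe_one, fun h => sl_ext h⟩

/-- Cayley–Hamilton for determinant-one matrices. -/
lemma sl_sq {F : Type*} [Field F] (g : SpecialLinearGroup (Fin 2) F) :
    (g : Matrix (Fin 2) (Fin 2) F) * g = (trace (g : Matrix (Fin 2) (Fin 2) F)) • (g : Matrix (Fin 2) (Fin 2) F) - 1 := by
  have h := g.2
  rw [det_fin_two] at h
  ext i j
  fin_cases i <;> fin_cases j <;> simp [Matrix.mul_apply, trace_fin_two, Fin.sum_univ_two] <;>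
    first | linear_combination (-1 : F) * h | linear_combination h | ring

def NonScal {F : Type*} [Field F] (g : SpecialLinearGroup (Fin 2) F) : Prop :=
  ∀ a : F, (g : Matrix (Fin 2) (Fin 2) F) ≠ a • 1

lemma NonScal.coeff {F : Type*} [Field F] {g : SpecialLinearGroup (Fin 2) F} (hg : NonScal g)
    {a b c d : F} (h : a • (1 : Matrix (Fin 2) (Fin 2) F) + b • (g : Matrix (Fin 2) (Fin 2) F) =
      c • 1 + d • (g : Matrix (Fin 2) (Fin 2) F)) : a = c ∧ b = d := by
  have hb : b = d := by
    by_contra hne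
    have hne' : b - d ≠ 0 := sub_ne_zero.2 hne
    apply hg ((b - d)⁻¹ * (c - a))
    have : (b - d) • (g : Matrix (Fin 2) (Fin 2) F) = (c - a) • 1 := by
      rw [sub_smul, sub_smul, sub_eq_sub_iff_add_eq_add, add_comm, h, add_comm]
    rw [mul_smul, ← this, smul_smul, inv_mul_cancel₀ hne', one_smul]
  subst hb
  refine ⟨?_, rfl⟩
  have h2 := add_right_cancel h
  simpa using congrFun (congrFun h2 0) 0

lemma pow_form {F K : Type*} [Field F] [Field K] [Algebra F K] (g : SpecialLinearGroup (Fin 2) F)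
    (l m : K)
    (hl : l * l = algebraMap F K (trace (g : Matrix (Fin 2) (Fin 2) F)) * l - 1)
    (hm : m * m = algebraMap F K (trace (g : Matrix (Fin 2) (Fin 2) F)) * m - 1) (k : ℕ) :
    ∃ a b : F, (g : Matrix (Fin 2) (Fin 2) F) ^ k = a • 1 + b • (g : Matrix (Fin 2) (Fin 2) F) ∧
      l ^ k = algebraMap F K a + algebraMap F K b * l ∧
      m ^ k = algebraMap F K a + algebraMap F K b * m := by
  induction k with
  | zero => exact ⟨1, 0, by simp, by simp, by simp⟩
  | succ k ih =>
    obtain ⟨a, b, h1, h2, h3⟩ := ih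
    refine ⟨-b, a + b * trace (g : Matrix (Fin 2) (Fin 2) F), ?_, ?_, ?_⟩
    · rw [pow_succ, h1, add_mul, smul_mul_assoc, smul_mul_assoc, sl_sq, one_mul]
      module
    · rw [pow_succ, h2, map_neg, map_add, map_mul]
      linear_combination algebraMap F K b * hl
    · rw [pow_succ, h3, map_neg, map_add, map_mul]
      linear_combination algebraMap F K b * hm

lemma uni_form {F : Type*} [Field F] (g : SpecialLinearGroup (Fin 2) F)
    (e : F) (he : e * e = 1) (ht : trace (g : Matrix (Fin 2) (Fin 2) F) = 2 * e) (k : ℕ) :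
    (g : Matrix (Fin 2) (Fin 2) F) ^ k =
      (e ^ k * (1 - k)) • 1 + (e ^ (k + 1) * k) • (g : Matrix (Fin 2) (Fin 2) F) := by
  induction k with
  | zero => simp
  | succ k ih =>
    rw [pow_succ, ih, add_mul, smul_mul_assoc, smul_mul_assoc, sl_sq, one_mul, ht]
    push_cast
    rw [smul_sub, smul_smul]
    have h1 : e ^ (k + 1) * (1 - ((k : F) + 1)) = - (e ^ (k + 1) * k) := by ring
    have h2 : e ^ (k + 1 + 1) * ((k : F) + 1) = e ^ k * (1 - k) + e ^ (k + 1) * k * (2 * e) := by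
      linear_combination (e ^ k * (1 - k)) * he
    rw [h1, h2]
    module

lemma commute_form {F : Type*} [Field F] {g : SpecialLinearGroup (Fin 2) F} (hg : NonScal g)
    (x : Matrix (Fin 2) (Fin 2) F) (h : x * (g : Matrix (Fin 2) (Fin 2) F) = g * x) :
    ∃ a b : F, x = a • 1 + b • (g : Matrix (Fin 2) (Fin 2) F) := by
  have e00 := congrFun (congrFun h 0) 0
  have e01 := congrFun (congrFun h 0) 1
  have e10 := congrFun (congrFun h 1) 0
  simp only [Matrix.mul_apply, Fin.sum_univ_two] at e00 e01 e10
  have key : ∀ a b : F, x 0 0 = a + b * g.1 0 0 → x 0 1 = b * g.1 0 1 → x 1 0 = b * g.1 1 0 →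
      x 1 1 = a + b * g.1 1 1 → ∃ a b : F, x = a • 1 + b • (g : Matrix (Fin 2) (Fin 2) F) := by
    intro a b h1 h2 h3 h4
    refine ⟨a, b, ?_⟩
    ext i j
    fin_cases i <;> fin_cases j <;> simp [h1, h2, h3, h4]
  by_cases hq : g.1 0 1 = 0
  · by_cases hr : g.1 1 0 = 0
    · have hps : g.1 0 0 - g.1 1 1 ≠ 0 := by
        intro hps
        apply hg (g.1 0 0)
        ext i j
        fin_cases i <;> fin_cases j <;> simp [hq, hr]
        exact (sub_eq_zero.1 hps).symm
      rw [hq] at e01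
      rw [hr] at e10
      have h1 : x 0 1 = 0 := by
        apply mul_left_cancel₀ hps; linear_combination -e01
      have h2 : x 1 0 = 0 := by
        apply mul_left_cancel₀ hps; linear_combination e10
      refine key (x 0 0 - (x 0 0 - x 1 1) / (g.1 0 0 - g.1 1 1) * g.1 0 0)
        ((x 0 0 - x 1 1) / (g.1 0 0 - g.1 1 1)) (by ring) (by simp [h1, hq]) (by simp [h2, hr]) ?_
      field_simp
      ring
    · refine key (x 0 0 - x 1 0 / g.1 1 0 * g.1 0 0) (x 1 0 / g.1 1 0) (by ring) ?_
        (by field_simp) ?_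
      · field_simp
        linear_combination e00
      · field_simp
        linear_combination e10
  · refine key (x 0 0 - x 0 1 / g.1 0 1 * g.1 0 0) (x 0 1 / g.1 0 1) (by ring) (by field_simp) ?_ ?_
    · field_simp
      linear_combination -e00
    · field_simp
      linear_combination -e01

/-- An element with `det (v, g v) = 1` is conjugate to a companion matrix. -/
lemma conj_comp {F : Type*} [Field F] {g : SpecialLinearGroup (Fin 2) F} (x y : F)
    (h : g.1 1 0 * x ^ 2 + (g.1 1 1 - g.1 0 0) * x * y - g.1 0 1 * y ^ 2 = 1) :
    ∃ P : SpecialLinearGroup (Fin 2) F, g.1 * P.1 =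
      P.1 * !![0, -1; 1, trace (g : Matrix (Fin 2) (Fin 2) F)] := by
  refine ⟨⟨!![x, g.1 0 0 * x + g.1 0 1 * y; y, g.1 1 0 * x + g.1 1 1 * y], ?_⟩, ?_⟩
  · rw [det_fin_two_of]; linear_combination h
  · have hd := g.2
    rw [det_fin_two] at hd
    ext i j
    fin_cases i <;> fin_cases j <;>
      simp [Matrix.mul_apply, trace_fin_two, Fin.sum_univ_two]
    · linear_combination (-x) * hd
    · linear_combination (-y) * hd

lemma conj_of_comp {F : Type*} [Field F] {g g' : SpecialLinearGroup (Fin 2) F}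
    (h : ∃ P : SpecialLinearGroup (Fin 2) F, g.1 * P.1 =
      P.1 * !![0, -1; 1, trace (g : Matrix (Fin 2) (Fin 2) F)])
    (h' : ∃ P : SpecialLinearGroup (Fin 2) F, g'.1 * P.1 =
      P.1 * !![0, -1; 1, trace (g' : Matrix (Fin 2) (Fin 2) F)])
    (ht : trace (g : Matrix (Fin 2) (Fin 2) F) = trace (g' : Matrix (Fin 2) (Fin 2) F)) :
    ∃ h : SpecialLinearGroup (Fin 2) F, h * g * h⁻¹ = g' := by
  obtain ⟨P, hP⟩ := h
  obtain ⟨Q, hQ⟩ := h'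
  rw [← ht] at hQ
  let c : SpecialLinearGroup (Fin 2) F :=
    ⟨!![0, -1; 1, trace (g : Matrix (Fin 2) (Fin 2) F)], by rw [det_fin_two_of]; ring⟩
  have hP' : g * P = P * c := Subtype.ext hP
  have hQ' : g' * Q = Q * c := Subtype.ext hQ
  refine ⟨Q * P⁻¹, ?_⟩
  have h1 : g = P * c * P⁻¹ := by rw [← hP']; group
  have h2 : g' = Q * c * Q⁻¹ := by rw [← hQ']; group
  rw [h1, h2]; group

/-- Nondegenerate binary quadratic forms represent one. -/
lemma rep_one {F : Type*} [Field F] [Fintype F] (h2 : (2 : F) ≠ 0) (hF : ringChar F ≠ 2)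
    (c d b : F) (hD : d ^ 2 + 4 * c * b ≠ 0) :
    ∃ x y : F, c * x ^ 2 + d * x * y - b * y ^ 2 = 1 := by
  have aux : ∀ c d b : F, d ^ 2 + 4 * c * b ≠ 0 → c ≠ 0 →
      ∃ x y : F, c * x ^ 2 + d * x * y - b * y ^ 2 = 1 := by
    intro c d b hD hc
    obtain ⟨u, y, huy⟩ := FiniteField.exists_root_sum_quadratic
      (f := Polynomial.X ^ 2)
      (g := Polynomial.C (-(d ^ 2 + 4 * c * b)) * Polynomial.X ^ 2 + Polynomial.C 0 * Polynomial.X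
        + Polynomial.C (-(4 * c))) (R := F)
      (by simp) (Polynomial.degree_quadratic (neg_ne_zero.2 hD))
      (by
        rw [← Nat.card_eq_fintype_card]
        have := FiniteField.odd_card_of_char_ne_two hF
        first | exact this | (rw [Nat.card_eq_fintype_card]; exact this))
    simp at huy
    refine ⟨(u - d * y) / (2 * c), y, ?_⟩
    have h4 : (4 : F) ≠ 0 := by
      have : (4 : F) = 2 * 2 := by norm_num
      rw [this]; exact mul_ne_zero h2 h2
    apply mul_left_cancel₀ (mul_ne_zero h4 hc)
    field_simp
    linear_combination huy
  by_cases hc : c = 0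
  · by_cases hb : b = 0
    · subst hc hb
      have hd : d ≠ 0 := by rintro rfl; simp at hD
      exact ⟨1, d⁻¹, by field_simp; simp⟩
    · obtain ⟨x, y, h⟩ := aux (-b) d (-c) (by convert hD using 1; ring) (neg_ne_zero.2 hb)
      exact ⟨y, x, by linear_combination h⟩
  · exact aux c d b hD hc

lemma trace_form {F : Type*} [Field F] (x : Matrix (Fin 2) (Fin 2) F) (a b : F) :
    trace (a • (1 : Matrix (Fin 2) (Fin 2) F) + b • x) = 2 * a + b * trace x := by
  simp [trace_fin_two]; ring

lemma nonScal_of_trace {F : Type*} [Field F] {g : SpecialLinearGroup (Fin 2) F}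
    (ht : trace (g : Matrix (Fin 2) (Fin 2) F) ^ 2 ≠ 4) : NonScal g := by
  intro a ha
  apply ht
  have hd := g.2
  rw [ha, det_fin_two] at hd
  rw [ha, trace_fin_two]
  simp at hd ⊢
  linear_combination 4 * hd

lemma exists_eig {F K : Type*} [Field F] [Field K] [Algebra F K] [IsAlgClosed K] (t : F)
    (ht : t ^ 2 ≠ 4) : ∃ l m : K, l * m = 1 ∧ l + m = algebraMap F K t ∧ l ≠ m := by
  set T := algebraMap F K t with hT
  have hdeg : (Polynomial.C 1 * Polynomial.X ^ 2 + Polynomial.C (-T) * Polynomial.X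
      + Polynomial.C (1 : K)).degree = 2 := Polynomial.degree_quadratic one_ne_zero
  obtain ⟨l, hl⟩ := IsAlgClosed.exists_root _ (by rw [hdeg]; decide)
  simp at hl
  refine ⟨l, T - l, by linear_combination -hl, by ring, ?_⟩
  intro h
  apply ht
  apply (algebraMap F K).injective
  rw [map_pow, ← hT, map_ofNat]
  have : T = 2 * l := by linear_combination -h
  rw [this] at hl ⊢
  linear_combination -4 * hl

lemma eig_order {F K : Type*} [Field F] [Field K] [Algebra F K]
    {g : SpecialLinearGroup (Fin 2) F} (hg : NonScal g) {l m : K} (hlm : l * m = 1)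
    (hs : l + m = algebraMap F K (trace (g : Matrix (Fin 2) (Fin 2) F))) (hne : l ≠ m) :
    orderOf g = orderOf l := by
  rw [orderOf_eq_orderOf_iff]
  intro k
  obtain ⟨a, b, h1, h2, h3⟩ := pow_form g l m (by rw [← hs]; linear_combination -hlm)
    (by rw [← hs]; linear_combination -hlm) k
  have hk : g ^ k = 1 ↔ (g : Matrix (Fin 2) (Fin 2) F) ^ k = 1 := sl_pow_one g _
  rw [hk]
  constructor
  · intro h
    rw [h] at h1
    obtain ⟨ha, hb⟩ := hg.coeff (a := 1) (b := 0) (c := a) (d := b) (by simpa using h1)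
    rw [h2, ← ha, ← hb]; simp
  · intro h
    have hm : m ^ k = 1 := by
      have := congrArg (· ^ k) hlm
      simpa [mul_pow, h] using this
    rw [h] at h2
    rw [hm] at h3
    have hb : b = 0 := by
      have : algebraMap F K b * (l - m) = 0 := by linear_combination h3 - h2
      simpa [sub_ne_zero.2 hne] using this
    have ha : a = 1 := by
      apply (algebraMap F K).injective
      rw [hb] at h2; simpa using h2.symm
    rw [h1, ha, hb]; simp

lemma trace_sq_cases {F : Type*} [Field F] (h2 : (2 : F) ≠ 0) {t : F} (ht : t ^ 2 = 4) :
    ∃ e : F, e * e = 1 ∧ t = 2 * e := by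
  refine ⟨t / 2, ?_, by field_simp⟩
  field_simp
  linear_combination ht

section
variable {p : ℕ} [Fact p.Prime]

lemma odd_rep (hodd : Odd p) (b : ZMod p) : ∃ k : ℕ, Odd k ∧ (k : ZMod p) = b := by
  rcases Nat.even_or_odd b.val with h | h
  · exact ⟨b.val + p, h.add_odd hodd, by simp⟩
  · exact ⟨b.val, h, by simp⟩

lemma uni_odd {g : SpecialLinearGroup (Fin 2) (ZMod p)} {e : ZMod p} (he : e * e = 1)
    (ht : trace (g : Matrix (Fin 2) (Fin 2) (ZMod p)) = 2 * e) {k : ℕ} (hk : Odd k) :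
    (g : Matrix (Fin 2) (Fin 2) (ZMod p)) ^ k =
      (e * (1 - k)) • 1 + (k : ZMod p) • (g : Matrix (Fin 2) (Fin 2) (ZMod p)) := by
  rw [uni_form g e he ht k]
  have h1 : e ^ k = e := by
    obtain ⟨j, rfl⟩ := hk
    rw [pow_succ, pow_mul, pow_two, he, one_pow, one_mul]
  rw [pow_succ, h1, he, one_mul]

lemma uni_dvd {g : SpecialLinearGroup (Fin 2) (ZMod p)} (hg : NonScal g) {e : ZMod p}
    (he : e * e = 1) (ht : trace (g : Matrix (Fin 2) (Fin 2) (ZMod p)) = 2 * e) :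
    p ∣ orderOf g := by
  have h1 : (g : Matrix (Fin 2) (Fin 2) (ZMod p)) ^ orderOf g = 1 := (sl_pow_one g _).1 (pow_orderOf_eq_one g)
  rw [uni_form g e he ht] at h1
  have h3 := (hg.coeff (c := 1) (d := 0) (by simpa using h1)).2
  have he0 : e ≠ 0 := by rintro rfl; simp at he
  rw [← ZMod.natCast_eq_zero_iff]
  simpa [he0] using h3

lemma uni_pow_p (hodd : Odd p) {g : SpecialLinearGroup (Fin 2) (ZMod p)} {e : ZMod p}
    (he : e * e = 1) (ht : trace (g : Matrix (Fin 2) (Fin 2) (ZMod p)) = 2 * e) :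
    orderOf g ∣ p ↔ e = 1 := by
  rw [orderOf_dvd_iff_pow_eq_one]
  have hk : g ^ p = 1 ↔ (g : Matrix (Fin 2) (Fin 2) (ZMod p)) ^ p = 1 := sl_pow_one g _
  rw [hk, uni_odd he ht hodd]
  constructor
  · intro h
    simpa using congrFun (congrFun h 0) 0
  · rintro rfl; simp

lemma ss_not_dvd {g : SpecialLinearGroup (Fin 2) (ZMod p)}
    (ht : trace (g : Matrix (Fin 2) (Fin 2) (ZMod p)) ^ 2 ≠ 4) : ¬ p ∣ orderOf g := by
  obtain ⟨l, m, hlm, hs, hne⟩ := exists_eig (K := AlgebraicClosure (ZMod p)) _ ht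
  have ho := eig_order (nonScal_of_trace ht) hlm hs hne
  have hpos := orderOf_pos g
  rintro ⟨j, hj⟩
  have h1 : (l ^ j) ^ p = 1 := by
    rw [← pow_mul, mul_comm, ← hj, ho, pow_orderOf_eq_one]
  have h2 : l ^ j = 1 := by
    apply frobenius_inj (AlgebraicClosure (ZMod p)) p
    simpa [frobenius_def] using h1
  have h3 := orderOf_dvd_of_pow_eq_one h2
  rw [← ho] at h3
  have hj0 : 0 < j := by
    rcases Nat.eq_zero_or_pos j with h | h
    · subst h; omega
    · exact h
  have h4 := Nat.le_of_dvd hj0 h3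
  have hp2 := (Fact.out : p.Prime).two_le
  nlinarith

lemma two_ne (hodd : Odd p) : (2 : ZMod p) ≠ 0 := by
  intro h
  have : ((2 : ℕ) : ZMod p) = 0 := by exact_mod_cast h
  rw [ZMod.natCast_eq_zero_iff] at this
  have h2 := (Nat.prime_dvd_prime_iff_eq Fact.out Nat.prime_two).1 this
  subst h2
  exact absurd hodd (by decide)

lemma dichotomy (hodd : Odd p) {g g' : SpecialLinearGroup (Fin 2) (ZMod p)} (hg : NonScal g)
    (hg' : NonScal g') (ho : orderOf g = orderOf g') :
    (trace (g : Matrix (Fin 2) (Fin 2) (ZMod p)) ^ 2 ≠ 4 ∧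
      trace (g' : Matrix (Fin 2) (Fin 2) (ZMod p)) ^ 2 ≠ 4) ∨
    ∃ e : ZMod p, e * e = 1 ∧ trace (g : Matrix (Fin 2) (Fin 2) (ZMod p)) = 2 * e ∧
      trace (g' : Matrix (Fin 2) (Fin 2) (ZMod p)) = 2 * e := by
  have h2 := two_ne hodd
  by_cases h : trace (g : Matrix (Fin 2) (Fin 2) (ZMod p)) ^ 2 = 4
  · obtain ⟨e, he, ht⟩ := trace_sq_cases h2 h
    by_cases h' : trace (g' : Matrix (Fin 2) (Fin 2) (ZMod p)) ^ 2 = 4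
    · obtain ⟨e', he', ht'⟩ := trace_sq_cases h2 h'
      right
      refine ⟨e, he, ht, ?_⟩
      have h1 := uni_pow_p hodd he ht
      have h1' := uni_pow_p hodd he' ht'
      rw [ho, h1'] at h1
      have : e = e' := by
        rcases mul_self_eq_one_iff.1 he with h3 | h3
        · rw [h3, h1.2 h3]
        · rcases mul_self_eq_one_iff.1 he' with h4 | h4
          · rw [h4, h1.1 h4]
          · rw [h3, h4]
      rw [this, ht']
    · exact absurd (ho ▸ uni_dvd hg he ht) (ss_not_dvd h')
  · left
    refine ⟨h, ?_⟩
    intro h'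
    obtain ⟨e', he', ht'⟩ := trace_sq_cases h2 h'
    exact ss_not_dvd h (ho ▸ uni_dvd hg' he' ht')

lemma uni_mem (hodd : Odd p) {u x : SpecialLinearGroup (Fin 2) (ZMod p)} (hu : NonScal u)
    {e : ZMod p} (he : e * e = 1) (ht : trace (u : Matrix (Fin 2) (Fin 2) (ZMod p)) = 2 * e)
    (hx : trace (x : Matrix (Fin 2) (Fin 2) (ZMod p)) = 2 * e) (hc : x * u = u * x) :
    x ∈ Subgroup.zpowers u := by
  obtain ⟨a, b, hab⟩ := commute_form hu x.1 (by simpa using congrArg Subtype.val hc)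
  rw [hab, trace_form, ht] at hx
  have h1 : a = e * (1 - b) := by
    apply mul_left_cancel₀ (two_ne hodd); linear_combination hx
  obtain ⟨k, hk, hkb⟩ := odd_rep hodd b
  have : x = u ^ k := by
    apply sl_ext
    rw [hab, h1, ← hkb, sl_coe_pow, uni_odd he ht hk]
  rw [this]
  exact Subgroup.npow_mem_zpowers u k

lemma uni_comp (hodd : Odd p) {u : SpecialLinearGroup (Fin 2) (ZMod p)} (hu : NonScal u)
    {e : ZMod p} (he : e * e = 1) (ht : trace (u : Matrix (Fin 2) (Fin 2) (ZMod p)) = 2 * e) :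
    ∃ w : SpecialLinearGroup (Fin 2) (ZMod p), Subgroup.zpowers w = Subgroup.zpowers u ∧
      trace (w : Matrix (Fin 2) (Fin 2) (ZMod p)) = 2 * e ∧
      ∃ P : SpecialLinearGroup (Fin 2) (ZMod p), w.1 * P.1 =
        P.1 * !![0, -1; 1, trace (w : Matrix (Fin 2) (Fin 2) (ZMod p))] := by
  obtain ⟨x, y, hq⟩ : ∃ x y : ZMod p,
      u.1 1 0 * x ^ 2 + (u.1 1 1 - u.1 0 0) * x * y - u.1 0 1 * y ^ 2 ≠ 0 := by
    by_contra! hcon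
    have h1 := hcon 1 0
    have h2 := hcon 0 1
    have h3 := hcon 1 1
    simp at h1 h2
    simp [h1, h2] at h3
    apply hu (u.1 0 0)
    ext i j
    fin_cases i <;> fin_cases j <;> simp [h1, h2]
    linear_combination h3
  set q := u.1 1 0 * x ^ 2 + (u.1 1 1 - u.1 0 0) * x * y - u.1 0 1 * y ^ 2 with hqdef
  obtain ⟨k, hk, hkq⟩ := odd_rep hodd q⁻¹
  have hw : (u ^ k).1 = (e * (1 - k)) • 1 + (k : ZMod p) • u.1 := by
    rw [sl_coe_pow, uni_odd he ht hk]
  have hk0 : (k : ZMod p) ≠ 0 := by rw [hkq]; exact inv_ne_zero hq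
  have htw : trace (u ^ k).1 = 2 * e := by
    rw [hw, trace_form, ht]; ring
  have hwN : NonScal (u ^ k) := by
    intro a ha
    rw [hw] at ha
    exact hk0 (hu.coeff (c := a) (d := 0) (by simpa using ha)).2
  refine ⟨u ^ k, ?_, htw, ?_⟩
  · apply le_antisymm
    · rw [Subgroup.zpowers_le]; exact Subgroup.npow_mem_zpowers u k
    · rw [Subgroup.zpowers_le]
      exact uni_mem hodd hwN he htw ht (by rw [← pow_succ, ← pow_succ'])
  · apply conj_comp x y
    rw [hw]
    simp
    have : (k : ZMod p) * q = 1 := by rw [hkq, inv_mul_cancel₀ hq]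
    rw [hqdef] at this
    linear_combination this

lemma ss_comp (hodd : Odd p) {g : SpecialLinearGroup (Fin 2) (ZMod p)}
    (ht : trace (g : Matrix (Fin 2) (Fin 2) (ZMod p)) ^ 2 ≠ 4) :
    ∃ P : SpecialLinearGroup (Fin 2) (ZMod p), g.1 * P.1 =
        P.1 * !![0, -1; 1, trace (g : Matrix (Fin 2) (Fin 2) (ZMod p))] := by
  have h2 := two_ne hodd
  obtain ⟨x, y, h⟩ := rep_one h2 (by
    rw [ZMod.ringChar_zmod_n]; rintro rfl; exact absurd hodd (by decide))
    (g.1 1 0) (g.1 1 1 - g.1 0 0) (g.1 0 1) (by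
      intro h
      apply ht
      have hd := g.2
      rw [det_fin_two] at hd
      rw [trace_fin_two]
      linear_combination h + 4 * hd)
  exact conj_comp x y h

lemma eq_of_mem_of_order {G : Type*} [Group G] [Finite G] {g u : G}
    (h : u ∈ Subgroup.zpowers g) (ho : orderOf g = orderOf u) :
    Subgroup.zpowers u = Subgroup.zpowers g := by
  apply Subgroup.eq_of_le_of_card_ge
  · rwa [Subgroup.zpowers_le]
  · rw [Nat.card_zpowers, Nat.card_zpowers, ho]

lemma conj_main (hodd : Odd p) {g g' : SpecialLinearGroup (Fin 2) (ZMod p)} (hg : NonScal g)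
    (hg' : NonScal g') (ho : orderOf g = orderOf g') :
    ∃ h u u' : SpecialLinearGroup (Fin 2) (ZMod p), Subgroup.zpowers u = Subgroup.zpowers g ∧
      Subgroup.zpowers u' = Subgroup.zpowers g' ∧ h * u * h⁻¹ = u' := by
  rcases dichotomy hodd hg hg' ho with ⟨ht, ht'⟩ | ⟨e, he, ht, ht'⟩
  · obtain ⟨l, m, hlm, hs, hne⟩ := exists_eig (K := AlgebraicClosure (ZMod p)) _ ht
    obtain ⟨l', m', hlm', hs', hne'⟩ := exists_eig (K := AlgebraicClosure (ZMod p)) _ ht'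
    have h1 := eig_order hg hlm hs hne
    have h1' := eig_order hg' hlm' hs' hne'
    have hprim : IsPrimitiveRoot l (orderOf l) := IsPrimitiveRoot.orderOf l
    have : NeZero (orderOf l) := ⟨by rw [← h1]; exact (orderOf_pos g).ne'⟩
    obtain ⟨k, -, hk⟩ := hprim.eq_pow_of_pow_eq_one (ξ := l')
      (by rw [← h1, ho, h1', pow_orderOf_eq_one])
    have hlz : l' ≠ 0 := by rintro rfl; simp at hlm'
    have hmk : m ^ k = m' := by
      apply mul_left_cancel₀ hlz
      rw [hlm', ← hk, ← mul_pow, hlm, one_pow]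
    obtain ⟨a, b, e1, e2, e3⟩ := pow_form g l m (by rw [← hs]; linear_combination -hlm)
      (by rw [← hs]; linear_combination -hlm) k
    have htr : trace (g ^ k).1 = trace g'.1 := by
      apply (algebraMap (ZMod p) (AlgebraicClosure (ZMod p))).injective
      rw [sl_coe_pow, e1, trace_form, ← hs', ← hk, ← hmk, e2, e3, map_add, map_mul,
        map_mul, ← hs, map_ofNat]
      ring
    obtain ⟨h, hh⟩ := conj_of_comp (ss_comp hodd (g := g ^ k) (by rw [htr]; exact ht'))
      (ss_comp hodd ht') htr
    refine ⟨h, g ^ k, g', ?_, rfl, hh⟩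
    apply eq_of_mem_of_order (Subgroup.npow_mem_zpowers g k)
    rw [ho, ← hh]
    exact (MulEquiv.orderOf_eq (MulAut.conj h) (g ^ k))
  · obtain ⟨u, hu1, hu2, hu3⟩ := uni_comp hodd hg he ht
    obtain ⟨u', hu1', hu2', hu3'⟩ := uni_comp hodd hg' he ht'
    obtain ⟨h, hh⟩ := conj_of_comp hu3 hu3' (hu2.trans hu2'.symm)
    exact ⟨h, u, u', hu1, hu1', hh⟩

lemma inter_main (hodd : Odd p) {g g' : SpecialLinearGroup (Fin 2) (ZMod p)} (hg : NonScal g)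
    (hg' : NonScal g') (ho : orderOf g = orderOf g') (hc : g * g' = g' * g) :
    Subgroup.zpowers g = Subgroup.zpowers g' := by
  refine eq_of_mem_of_order ?_ ho.symm
  rcases dichotomy hodd hg hg' ho with ⟨ht, ht'⟩ | ⟨e, he, ht, ht'⟩
  · obtain ⟨l', m', hlm', hs', hne'⟩ := exists_eig (K := AlgebraicClosure (ZMod p)) _ ht'
    obtain ⟨a, b, hab⟩ := commute_form hg' g.1 (by simpa using congrArg Subtype.val hc)
    set f := algebraMap (ZMod p) (AlgebraicClosure (ZMod p)) with hf
    have hb : b ≠ 0 := by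
      rintro rfl
      exact hg a (by simpa using hab)
    have hfb : f b ≠ 0 := by simpa using hb
    have hdet : a ^ 2 + a * b * trace g'.1 + b ^ 2 = 1 := by
      have hd := g.2
      have hd' := g'.2
      rw [hab, det_fin_two] at hd
      rw [det_fin_two] at hd'
      rw [trace_fin_two]
      simp at hd
      linear_combination hd - b ^ 2 * hd'
    have hdet' := congrArg f hdet
    simp only [map_add, map_mul, map_pow, map_one] at hdet'
    have h1 := eig_order (l := f a + f b * l') (m := f a + f b * m') hg
      (by rw [← hs'] at hdet'; linear_combination hdet' + f b ^ 2 * hlm')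
      (by rw [hab, trace_form, map_add, map_mul, map_mul, ← hs', map_ofNat]; ring)
      (by
        intro h
        exact hne' (mul_left_cancel₀ hfb (add_left_cancel h)))
    have h1' := eig_order hg' hlm' hs' hne'
    have hprim : IsPrimitiveRoot l' (orderOf l') := IsPrimitiveRoot.orderOf l'
    have : NeZero (orderOf l') := ⟨by rw [← h1']; exact (orderOf_pos g').ne'⟩
    obtain ⟨k, -, hk⟩ := hprim.eq_pow_of_pow_eq_one (ξ := f a + f b * l')
      (by rw [← h1', ← ho, h1, pow_orderOf_eq_one])
    obtain ⟨c, d, e1, e2, e3⟩ := pow_form g' l' m' (by rw [← hs']; linear_combination -hlm')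
      (by rw [← hs']; linear_combination -hlm') k
    have hmk : m' ^ k = f a + f b * m' := by
      have hl0 : l' ^ k ≠ 0 := pow_ne_zero _ (by rintro rfl; simp at hlm')
      apply mul_left_cancel₀ hl0
      rw [← mul_pow, hlm', one_pow, hk]
      rw [← hs'] at hdet'; linear_combination -hdet' - f b ^ 2 * hlm'
    have e4 : f a + f b * l' = f c + f d * l' := by rw [← hk, e2]
    have e5 : f a + f b * m' = f c + f d * m' := by rw [← hmk, e3]
    have hbd : f b = f d := by
      apply mul_right_cancel₀ (sub_ne_zero.2 hne')
      linear_combination e4 - e5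
    have hac : f a = f c := by rw [hbd] at e4; exact add_right_cancel e4
    have : g = g' ^ k := by
      apply sl_ext
      rw [sl_coe_pow, e1, hab, f.injective hbd, f.injective hac]
    rw [this]
    exact Subgroup.npow_mem_zpowers g' k
  · exact uni_mem hodd hg' he ht' ht hc

lemma scal_cases {g : SpecialLinearGroup (Fin 2) (ZMod p)} (hg : ¬ NonScal g) :
    g = 1 ∨ g = -1 := by
  unfold NonScal at hg
  push Not at hg
  obtain ⟨a, ha⟩ := hg
  have hd := g.2
  rw [ha, det_fin_two] at hd
  simp at hd
  rcases mul_self_eq_one_iff.1 hd with h | h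
  · left; apply Subtype.ext; rw [ha, h]; simp
  · right; apply Subtype.ext; rw [ha, h]; simp

lemma scal_of_sq (hodd : Odd p) {g : SpecialLinearGroup (Fin 2) (ZMod p)} (hg : g ^ 2 = 1) :
    ¬ NonScal g := by
  intro hN
  have h1 := sl_sq g
  have h2 : g.1 * g.1 = 1 := by
    have := congrArg Subtype.val hg
    simpa [pow_two] using this
  rw [h2] at h1
  have h3 := hN.coeff (a := 2) (b := 0) (c := 0) (d := trace g.1) (by
    rw [zero_smul, zero_smul, add_zero, zero_add, two_smul]
    nth_rewrite 1 [h1]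
    abel)
  exact two_ne hodd h3.1

/-- If one generator is scalar the subgroups agree. -/
lemma scal_eq (hodd : Odd p) {g g' : SpecialLinearGroup (Fin 2) (ZMod p)} (hg : ¬ NonScal g)
    (ho : orderOf g = orderOf g') : g = g' := by
  have hsq : g ^ 2 = 1 := by rcases scal_cases hg with rfl | rfl <;> simp
  have hsq' : g' ^ 2 = 1 := by
    rw [← orderOf_dvd_iff_pow_eq_one, ← ho]
    exact orderOf_dvd_of_pow_eq_one hsq
  rcases scal_cases hg with h | h <;> rcases scal_cases (scal_of_sq hodd hsq') with h' | h'
  · rw [h, h']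
  · rw [h, orderOf_one, eq_comm, orderOf_eq_one_iff] at ho
    rw [h, ho]
  · rw [h', orderOf_one, orderOf_eq_one_iff] at ho
    rw [h', ho]
  · rw [h, h']

lemma comm_of_mem {g x : SpecialLinearGroup (Fin 2) (ZMod p)} (hx : NonScal x) (_hg : NonScal g)
    (h : x ∈ Subgroup.zpowers g) : ∃ a b : ZMod p, g.1 = a • 1 + b • x.1 := by
  obtain ⟨k, rfl⟩ := Subgroup.mem_zpowers_iff.1 h
  apply commute_form hx
  have : g * g ^ k = g ^ k * g := (Commute.refl g).zpow_right k
  simpa using congrArg Subtype.val this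

end

theorem stmt_18 {p : ℕ} (hp : p.Prime) (hodd : Odd p)
    (C C' : Subgroup (Matrix.SpecialLinearGroup (Fin 2) (ZMod p)))
    (hC : IsCyclic C) (hC' : IsCyclic C')
    (hcard : Nat.card C = Nat.card C') :
    (∃ g : Matrix.SpecialLinearGroup (Fin 2) (ZMod p),
      C' = C.map (MulAut.conj g).toMonoidHom) ∧
    (C ≠ C' → ∀ x ∈ C ⊓ C',
      (x : Matrix (Fin 2) (Fin 2) (ZMod p)) = 1 ∨
      (x : Matrix (Fin 2) (Fin 2) (ZMod p)) = -1) := by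
  have : Fact p.Prime := ⟨hp⟩
  obtain ⟨g, rfl⟩ := (Subgroup.isCyclic_iff_exists_zpowers_eq_top C).1 hC
  obtain ⟨g', rfl⟩ := (Subgroup.isCyclic_iff_exists_zpowers_eq_top C').1 hC'
  rw [Nat.card_zpowers, Nat.card_zpowers] at hcard
  by_cases hg : NonScal g
  swap
  · have := scal_eq hodd hg hcard
    subst this
    refine ⟨⟨1, ?_⟩, fun h => absurd rfl h⟩
    rw [MonoidHom.map_zpowers]; simp
  by_cases hg' : NonScal g'
  swap
  · have := scal_eq hodd hg' hcard.symm
    subst this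
    exact absurd hg hg'
  constructor
  · obtain ⟨h, u, u', hu, hu', hh⟩ := conj_main hodd hg hg' hcard
    refine ⟨h, ?_⟩
    rw [← hu, ← hu', MonoidHom.map_zpowers, ← hh]
    simp
  · intro hne x hx
    by_contra hcon
    push Not at hcon
    have hxN : NonScal x := by
      by_contra hxs
      rcases scal_cases hxs with h | h
      · exact hcon.1 (by rw [h]; simp)
      · exact hcon.2 (by rw [h]; simp)
    obtain ⟨a, b, h1⟩ := comm_of_mem hxN hg hx.1
    obtain ⟨a', b', h2⟩ := comm_of_mem hxN hg' hx.2
    apply hne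
    apply inter_main hodd hg hg' hcard
    apply sl_ext
    rw [sl_coe_mul, sl_coe_mul, h1, h2]
    simp only [add_mul, mul_add, smul_mul_assoc, mul_smul_comm, one_mul, mul_one]
    module
end
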